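/- Open-loop controllability of the input-delayed linear system: let A : ℝ → Matrix (Fin n) (Fin n) ℝ, B : ℝ → Matrix (Fin n) (Fin m) ℝ and r : ℝ → ℝⁿ be measurable and bounded, let 0 < h < T, and assume the Grammian G_h := ∫_{h}^{T} Φ_A(T, s) B(s) B(s)ᵀ Φ_A(T, s)ᵀ ds is invertible. Then for all x₀, x_T ∈ ℝⁿ there exists a measurable square-integrable control u : ℝ → ℝᵐ with u(s) = 0 for s ∈ [−h, 0), namely u(t) := B(t + h)ᵀ Φ_A(T, t + h)ᵀ G_h⁻¹ (x_T − Φ_A(T, 0) x₀ − ∫_{0}^{T} Φ_A(T, s) r(s) ds) for t ∈ [0, T − h], such that the trajectory x(t) := Φ_A(t, 0) x₀ + ∫_{0}^{t} Φ_A(t, s) (B(s) u(s − h) + r(s)) ds of the delayed system x' = A x + B u(· − h) + r satisfies x(T) = x_T. -/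

import Mathlib

open MeasureTheory Matrix

/-- A measurable real function that is bounded on every bounded interval. -/
def MeasurableLocallyBounded (f : ℝ → ℝ) : Prop :=
  Measurable f ∧ ∀ R, ∃ C, ∀ x, |x| ≤ R → |f x| ≤ C

namespace MeasurableLocallyBounded

variable {f g : ℝ → ℝ}

lemma of_bounded (hf : Measurable f) {C : ℝ} (hC : ∀ x, |f x| ≤ C) :
    MeasurableLocallyBounded f :=
  ⟨hf, fun _ => ⟨C, fun x _ => hC x⟩⟩

lemma of_continuous (hf : Continuous f) : MeasurableLocallyBounded f := by
  refine ⟨hf.measurable, fun R => ?_⟩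
  obtain ⟨C, hC⟩ :=
    (isCompact_Icc (a := -R) (b := R)).exists_bound_of_continuousOn hf.continuousOn
  exact ⟨C, fun x hx => hC x (abs_le.1 hx)⟩

lemma mul (hf : MeasurableLocallyBounded f) (hg : MeasurableLocallyBounded g) :
    MeasurableLocallyBounded fun x => f x * g x := by
  refine ⟨hf.1.mul hg.1, fun R => ?_⟩
  obtain ⟨C, hC⟩ := hf.2 R
  obtain ⟨D, hD⟩ := hg.2 R
  refine ⟨C * D, fun x hx => ?_⟩
  rw [abs_mul]
  exact mul_le_mul (hC x hx) (hD x hx) (abs_nonneg _) ((abs_nonneg _).trans (hC x hx))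

lemma sum {ι : Type*} (s : Finset ι) {f : ι → ℝ → ℝ}
    (hf : ∀ i ∈ s, MeasurableLocallyBounded (f i)) :
    MeasurableLocallyBounded fun x => ∑ i ∈ s, f i x := by
  refine ⟨Finset.measurable_fun_sum s fun i hi => (hf i hi).1, fun R => ?_⟩
  have hbdd : ∀ i, ∃ C, i ∈ s → ∀ x, |x| ≤ R → |f i x| ≤ C := fun i => by
    by_cases hi : i ∈ s
    · exact ((hf i hi).2 R).imp fun C hC _ => hC
    · exact ⟨0, fun h => absurd h hi⟩
  choose C hC using hbdd
  exact ⟨∑ i ∈ s, C i, fun x hx => (Finset.abs_sum_le_sum_abs _ _).trans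
    (Finset.sum_le_sum fun i hi => hC i hi x hx)⟩

lemma comp_add_const (hf : MeasurableLocallyBounded f) (c : ℝ) :
    MeasurableLocallyBounded fun x => f (x + c) := by
  refine ⟨hf.1.comp (measurable_add_const c), fun R => ?_⟩
  obtain ⟨C, hC⟩ := hf.2 (R + |c|)
  exact ⟨C, fun x hx => hC _ ((abs_add_le x c).trans (by gcongr))⟩

lemma indicator (hf : MeasurableLocallyBounded f) {s : Set ℝ} (hs : MeasurableSet s) :
    MeasurableLocallyBounded (s.indicator f) := by
  refine ⟨hf.1.indicator hs, fun R => ?_⟩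
  obtain ⟨C, hC⟩ := hf.2 R
  exact ⟨C, fun x hx => (norm_indicator_le_norm_self f x).trans (hC x hx)⟩

lemma integrableOn_Icc (hf : MeasurableLocallyBounded f) (a b : ℝ) :
    IntegrableOn f (Set.Icc a b) := by
  obtain ⟨C, hC⟩ := hf.2 (max |a| |b|)
  refine IntegrableOn.of_bound measure_Icc_lt_top hf.1.aestronglyMeasurable C ?_
  filter_upwards [ae_restrict_mem measurableSet_Icc] with x hx
  exact hC x (abs_le_max_abs_abs hx.1 hx.2)

lemma intervalIntegrable (hf : MeasurableLocallyBounded f) (a b : ℝ) :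
    IntervalIntegrable f volume a b :=
  (hf.integrableOn_Icc (min a b) (max a b)).intervalIntegrable

lemma mulVec {ι κ : Type*} [Fintype κ] {M : ℝ → Matrix ι κ ℝ} {v : ℝ → κ → ℝ}
    (hM : ∀ i j, MeasurableLocallyBounded fun t => M t i j)
    (hv : ∀ j, MeasurableLocallyBounded fun t => v t j) (i : ι) :
    MeasurableLocallyBounded fun t => (M t *ᵥ v t) i :=
  sum _ fun j _ => (hM i j).mul (hv j)

lemma matrix_mul {ι κ l : Type*} [Fintype κ] {M : ℝ → Matrix ι κ ℝ} {N : ℝ → Matrix κ l ℝ}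
    (hM : ∀ i j, MeasurableLocallyBounded fun t => M t i j)
    (hN : ∀ i j, MeasurableLocallyBounded fun t => N t i j) (i : ι) (k : l) :
    MeasurableLocallyBounded fun t => (M t * N t) i k := by
  simp only [Matrix.mul_apply]
  exact sum _ fun j _ => (hM i j).mul (hN j k)

end MeasurableLocallyBounded

lemma eq_zero_of_le_abs_integral_of_le {g : ℝ → ℝ} (hg : Continuous g) (hg0 : ∀ t, 0 ≤ g t)
    {K s t : ℝ} (hle : ∀ t, g t ≤ K * |∫ q in s..t, g q|) (hst : s ≤ t) : g t = 0 := by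
  have hF : ∀ x, HasDerivAt (fun t => ∫ q in s..t, g q) (g x) x := fun x =>
    (hg.integral_hasStrictDerivAt s x).hasDerivAt
  have hzero := eq_zero_of_abs_deriv_le_mul_abs_self_of_eq_zero_right
    (f := fun t => ∫ q in s..t, g q) (f' := g) (K := K) (a := s) (b := t)
    (fun x _ => (hF x).continuousAt.continuousWithinAt)
    (fun x _ => (hF x).hasDerivWithinAt) (by simp)
    (fun x _ => by rw [Real.norm_of_nonneg (hg0 x)]; exact hle x) t ⟨hst, le_rfl⟩
  refine le_antisymm ((hle t).trans ?_) (hg0 t)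
  simp [hzero]

/-- Grönwall's inequality in integral form, with vanishing initial value. -/
lemma eq_zero_of_le_abs_integral {g : ℝ → ℝ} (hg : Continuous g) (hg0 : ∀ t, 0 ≤ g t)
    {K s : ℝ} (hle : ∀ t, g t ≤ K * |∫ q in s..t, g q|) (t : ℝ) : g t = 0 := by
  rcases le_total s t with hst | hts
  · exact eq_zero_of_le_abs_integral_of_le hg hg0 hle hst
  · have := eq_zero_of_le_abs_integral_of_le (g := fun x => g (-x)) (K := K) (s := -s) (t := -t)
      (hg.comp continuous_neg) (fun x => hg0 _) (fun x => ?_) (neg_le_neg hts)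
    · simpa using this
    · rw [intervalIntegral.integral_comp_neg, neg_neg, intervalIntegral.integral_symm, abs_neg]
      exact hle (-x)

section FundamentalMatrix

variable {n : ℕ} {A : ℝ → Matrix (Fin n) (Fin n) ℝ}

/-- Uniqueness for the linear integral equation `v t = ∫ q in s..t, A q *ᵥ v q`. -/
lemma eq_zero_of_eq_integral_mulVec
    (hAbdd : ∃ C : ℝ, ∀ t i j, |A t i j| ≤ C) {v : ℝ → Fin n → ℝ}
    (hv : ∀ i, Continuous fun t => v t i) {s : ℝ}
    (hveq : ∀ t i, v t i = ∫ q in s..t, (A q *ᵥ v q) i) (t : ℝ) : v t = 0 := by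
  obtain ⟨C, hC⟩ := hAbdd
  have hg : Continuous fun t => ∑ j, |v t j| := continuous_finsetSum _ fun j _ => (hv j).abs
  have hcoord : ∀ t i, |v t i| ≤ C * |∫ q in s..t, (∑ j, |v q j|)| := fun t i => by
    have hC0 : 0 ≤ C := (abs_nonneg _).trans (hC 0 i i)
    rw [hveq t i, ← abs_of_nonneg hC0, ← abs_mul, ← intervalIntegral.integral_const_mul]
    rw [← Real.norm_eq_abs (∫ q in s..t, (A q *ᵥ v q) i)]
    refine intervalIntegral.norm_integral_le_abs_of_norm_le (.of_forall fun q => ?_)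
      ((hg.const_mul C).intervalIntegrable _ _)
    rw [Finset.mul_sum, Real.norm_eq_abs, Matrix.mulVec, dotProduct]
    refine (Finset.abs_sum_le_sum_abs _ _).trans (Finset.sum_le_sum fun j _ => ?_)
    rw [abs_mul]
    exact mul_le_mul_of_nonneg_right (hC q i j) (abs_nonneg _)
  have hzero := eq_zero_of_le_abs_integral hg
    (fun t => Finset.sum_nonneg fun j _ => abs_nonneg _) (K := n * C) (s := s)
    (fun t => (Finset.sum_le_sum fun i _ => hcoord t i).trans_eq (by simp [mul_assoc])) t
  ext i
  exact abs_eq_zero.1 ((Finset.sum_eq_zero_iff_of_nonneg fun j _ => abs_nonneg _).1 hzero i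
    (Finset.mem_univ i))

variable {Φ : ℝ → ℝ → Matrix (Fin n) (Fin n) ℝ}

lemma fundamentalMatrix_self
    (hΦeq : ∀ s t i j, Φ t s i j
      = (1 : Matrix (Fin n) (Fin n) ℝ) i j + ∫ q in s..t, (A q * Φ q s) i j)
    (s : ℝ) : Φ s s = 1 := by
  ext i j
  simp [hΦeq s s i j]

/-- The cocycle property of the fundamental matrix. -/
lemma fundamentalMatrix_mul
    (hAmeas : ∀ i j, Measurable fun t => A t i j)
    (hAbdd : ∃ C : ℝ, ∀ t i j, |A t i j| ≤ C)
    (hΦcont : ∀ s i j, Continuous fun t => Φ t s i j)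
    (hΦeq : ∀ s t i j, Φ t s i j
      = (1 : Matrix (Fin n) (Fin n) ℝ) i j + ∫ q in s..t, (A q * Φ q s) i j)
    (t s a : ℝ) : Φ t s * Φ s a = Φ t a := by
  have hA : ∀ i j, MeasurableLocallyBounded fun t => A t i j := fun i j => by
    obtain ⟨C, hC⟩ := hAbdd
    exact .of_bounded (hAmeas i j) fun t => hC t i j
  have hAΦ : ∀ s i j, MeasurableLocallyBounded fun q => (A q * Φ q s) i j := fun s =>
    .matrix_mul hA fun i j => .of_continuous (hΦcont s i j)
  ext i j
  have hzero := eq_zero_of_eq_integral_mulVec hAbdd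
    (v := fun t i => (Φ t s * Φ s a - Φ t a) i j) (s := s) ?_ ?_ t
  · exact sub_eq_zero.1 (congrFun hzero i)
  · intro i
    simp only [Matrix.sub_apply, Matrix.mul_apply]
    exact (continuous_finsetSum _ fun k _ => (hΦcont s i k).mul_const _).sub (hΦcont a i j)
  · intro t i
    have hint : ∀ q, (A q *ᵥ fun i => (Φ q s * Φ s a - Φ q a) i j) i
        = ∑ k, (A q * Φ q s) i k * Φ s a k j - (A q * Φ q a) i j := fun q => by
      rw [← Matrix.mul_apply, Matrix.mul_assoc, ← Matrix.sub_apply, ← Matrix.mul_sub]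
      rfl
    simp only [hint]
    have hAΦsum : MeasurableLocallyBounded fun q => ∑ k, (A q * Φ q s) i k * Φ s a k j :=
      .sum _ fun k _ => (hAΦ s i k).mul (.of_continuous continuous_const)
    rw [intervalIntegral.integral_sub (hAΦsum.intervalIntegrable s t)
        ((hAΦ a i j).intervalIntegrable s t),
      intervalIntegral.integral_finsetSum
        fun k _ => ((hAΦ s i k).intervalIntegrable s t).mul_const _]
    simp only [intervalIntegral.integral_mul_const]
    have hadd := intervalIntegral.integral_add_adjacent_intervals
      ((hAΦ a i j).intervalIntegrable a s) ((hAΦ a i j).intervalIntegrable s t)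
    have hsum : (Φ t s * Φ s a) i j
        = Φ s a i j + ∑ k, (∫ q in s..t, (A q * Φ q s) i k) * Φ s a k j := by
      rw [Matrix.mul_apply]
      simp only [hΦeq s t i, add_mul, Finset.sum_add_distrib]
      rw [← Matrix.mul_apply, Matrix.one_mul]
    rw [Matrix.sub_apply, hsum, hΦeq a t i j, hΦeq a s i j]
    linarith

/-- The fundamental matrix depends continuously on its initial time. -/
lemma continuous_fundamentalMatrix_right
    (hAmeas : ∀ i j, Measurable fun t => A t i j)
    (hAbdd : ∃ C : ℝ, ∀ t i j, |A t i j| ≤ C)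
    (hΦcont : ∀ s i j, Continuous fun t => Φ t s i j)
    (hΦeq : ∀ s t i j, Φ t s i j
      = (1 : Matrix (Fin n) (Fin n) ℝ) i j + ∫ q in s..t, (A q * Φ q s) i j)
    (t : ℝ) : Continuous fun s => Φ t s := by
  have hright : ∀ s, Φ s 0 * Φ 0 s = 1 := fun s => by
    rw [fundamentalMatrix_mul hAmeas hAbdd hΦcont hΦeq, fundamentalMatrix_self hΦeq]
  have hdet : ∀ s, (Φ s 0).det ≠ 0 := fun s =>
    (Matrix.isUnit_det_of_right_inverse (hright s)).ne_zero
  have heq : (fun s => Φ t s) = fun s => Φ t 0 * ((Φ s 0).det⁻¹ • (Φ s 0).adjugate) := by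
    funext s
    rw [← fundamentalMatrix_mul hAmeas hAbdd hΦcont hΦeq t 0 s, ← Ring.inverse_eq_inv',
      ← Matrix.inv_def, Matrix.inv_eq_right_inv (hright s)]
  have hcont : Continuous fun s => Φ s 0 :=
    continuous_matrix fun i j => hΦcont 0 i j
  rw [heq]
  exact continuous_const.matrix_mul
    ((hcont.matrix_det.inv₀ hdet).smul hcont.matrix_adjugate)

end FundamentalMatrix

lemma intervalIntegral_apply {ι : Type*} [Fintype ι] {f : ℝ → ι → ℝ} {a b : ℝ}
    (hf : ∀ i, IntervalIntegrable (fun t => f t i) volume a b) (i : ι) :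
    (∫ t in a..b, f t) i = ∫ t in a..b, f t i := by
  simp only [intervalIntegral, Pi.sub_apply]
  rw [eval_integral fun i => (hf i).1, eval_integral fun i => (hf i).2]

/-- Open-loop controllability of the input-delayed linear system: if the Grammian
`G_h = ∫_h^T Φ_A(T,s) B(s) B(s)ᵀ Φ_A(T,s)ᵀ ds` is invertible, then for all `x₀, x_T`
there is a measurable square-integrable control `u` vanishing on `[-h, 0)`, given on
`[0, T-h]` by `u(t) = B(t+h)ᵀ Φ_A(T,t+h)ᵀ G_h⁻¹ (x_T − Φ_A(T,0) x₀ − ∫_0^T Φ_A(T,s) r(s) ds)`,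
such that the trajectory `x(t) = Φ_A(t,0) x₀ + ∫_0^t Φ_A(t,s) (B(s) u(s−h) + r(s)) ds`
of the delayed system satisfies `x(T) = x_T`. -/
theorem open_loop_controllability_delayed
    (n m : ℕ)
    (A : ℝ → Matrix (Fin n) (Fin n) ℝ)
    (hAmeas : ∀ i j, Measurable fun t => A t i j)
    (hAbdd : ∃ C : ℝ, ∀ t i j, |A t i j| ≤ C)
    (Φ : ℝ → ℝ → Matrix (Fin n) (Fin n) ℝ)
    (hΦcont : ∀ s i j, Continuous fun t => Φ t s i j)
    (hΦeq : ∀ s t i j, Φ t s i j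
        = (1 : Matrix (Fin n) (Fin n) ℝ) i j + ∫ q in s..t, (A q * Φ q s) i j)
    (B : ℝ → Matrix (Fin n) (Fin m) ℝ)
    (hBmeas : ∀ i j, Measurable fun t => B t i j)
    (hBbdd : ∃ C : ℝ, ∀ t i j, |B t i j| ≤ C)
    (r : ℝ → Fin n → ℝ)
    (hrmeas : ∀ i, Measurable fun t => r t i)
    (hrbdd : ∃ C : ℝ, ∀ t i, |r t i| ≤ C)
    (h T : ℝ) (hh : 0 < h) (hT : h < T)
    (Gh : Matrix (Fin n) (Fin n) ℝ)
    (hGh : ∀ i j, Gh i j = ∫ s in h..T, (Φ T s * B s * (B s)ᵀ * (Φ T s)ᵀ) i j)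
    (hGhinv : IsUnit Gh.det) :
    ∀ x₀ xT : Fin n → ℝ,
      ∃ u : ℝ → Fin m → ℝ,
        (∀ i, Measurable fun t => u t i) ∧
        IntegrableOn (fun t => ∑ i, (u t i) ^ 2) (Set.Icc (-h) T) ∧
        (∀ s ∈ Set.Ico (-h) (0 : ℝ), u s = 0) ∧
        (∀ t ∈ Set.Icc (0 : ℝ) (T - h),
          u t = (B (t + h))ᵀ.mulVec ((Φ T (t + h))ᵀ.mulVec (Gh⁻¹.mulVec
            (xT - (Φ T 0).mulVec x₀ - ∫ s in (0 : ℝ)..T, (Φ T s).mulVec (r s))))) ∧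
        ((Φ T 0).mulVec x₀
            + ∫ s in (0 : ℝ)..T, (Φ T s).mulVec ((B s).mulVec (u (s - h)) + r s)) = xT := by
  intro x₀ xT
  set p : Fin n → ℝ := Gh⁻¹ *ᵥ
    (xT - Φ T 0 *ᵥ x₀ - ∫ s in (0 : ℝ)..T, Φ T s *ᵥ r s) with hp
  have hΦ : ∀ i j, MeasurableLocallyBounded fun s => Φ T s i j := fun i j =>
    .of_continuous ((continuous_fundamentalMatrix_right hAmeas hAbdd hΦcont hΦeq T).matrix_elem i j)
  have hB : ∀ i j, MeasurableLocallyBounded fun s => B s i j := fun i j => by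
    obtain ⟨C, hC⟩ := hBbdd
    exact .of_bounded (hBmeas i j) fun t => hC t i j
  have hr : ∀ i, MeasurableLocallyBounded fun s => r s i := fun i => by
    obtain ⟨C, hC⟩ := hrbdd
    exact .of_bounded (hrmeas i) fun t => hC t i
  have hw : ∀ i, MeasurableLocallyBounded fun s => ((B s)ᵀ *ᵥ ((Φ T s)ᵀ *ᵥ p)) i :=
    .mulVec (fun i j => hB j i)
      (.mulVec (fun i j => hΦ j i) fun i => .of_continuous continuous_const)
  set u : ℝ → Fin m → ℝ := (Set.Icc 0 (T - h)).indicator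
    fun t => (B (t + h))ᵀ *ᵥ ((Φ T (t + h))ᵀ *ᵥ p) with hu
  have humlb : ∀ i, MeasurableLocallyBounded fun t => u t i := fun i => by
    convert ((hw i).comp_add_const h).indicator (measurableSet_Icc (a := (0 : ℝ)) (b := T - h))
      using 2 with t
    simp only [hu, Set.indicator_apply]
    split_ifs <;> rfl
  refine ⟨u, fun i => (humlb i).1, ?_, fun s hs => ?_, fun t ht => ?_, ?_⟩
  · simp only [sq]
    exact (MeasurableLocallyBounded.sum _ fun i _ =>
      (humlb i).mul (humlb i)).integrableOn_Icc _ _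
  · exact Set.indicator_of_notMem (fun h => hs.2.not_ge h.1) _
  · exact Set.indicator_of_mem ht _
  have hΦr : ∀ i, MeasurableLocallyBounded fun s => (Φ T s *ᵥ r s) i := .mulVec hΦ hr
  have hΦBu : ∀ i, MeasurableLocallyBounded fun s => (Φ T s *ᵥ (B s *ᵥ u (s - h))) i :=
    .mulVec hΦ (.mulVec hB fun i => (humlb i).comp_add_const (-h))
  have hGram : ∀ i j, MeasurableLocallyBounded fun s => (Φ T s * B s * (B s)ᵀ * (Φ T s)ᵀ) i j :=
    .matrix_mul (.matrix_mul (.matrix_mul hΦ hB) fun i j => hB j i) fun i j => hΦ j i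
  have hsteer : ∀ i, ∫ s in (0 : ℝ)..T, (Φ T s *ᵥ (B s *ᵥ u (s - h))) i = (Gh *ᵥ p) i := by
    intro i
    have hind : (fun s => (Φ T s *ᵥ (B s *ᵥ u (s - h))) i) = (Set.Icc h T).indicator
        fun s => ((Φ T s * B s * (B s)ᵀ * (Φ T s)ᵀ) *ᵥ p) i := by
      funext s
      by_cases hs : s ∈ Set.Icc h T
      · have hs' : s - h ∈ Set.Icc 0 (T - h) :=
          ⟨sub_nonneg.2 hs.1, sub_le_sub_right hs.2 h⟩
        rw [Set.indicator_of_mem hs, hu, Set.indicator_of_mem hs']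
        simp only [sub_add_cancel, Matrix.mulVec_mulVec, Matrix.mul_assoc]
      · have hs' : s - h ∉ Set.Icc 0 (T - h) := fun H =>
          hs ⟨sub_nonneg.1 H.1, (sub_le_sub_iff_right h).1 H.2⟩
        rw [Set.indicator_of_notMem hs, hu, Set.indicator_of_notMem hs']
        simp
    have hinter : Set.Ioc 0 T ∩ Set.Icc h T = Set.Icc h T :=
      Set.inter_eq_right.2 fun s hs => ⟨hh.trans_le hs.1, hs.2⟩
    rw [hind, intervalIntegral.integral_of_le (hh.trans hT).le,
      setIntegral_indicator measurableSet_Icc, hinter, integral_Icc_eq_integral_Ioc,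
      ← intervalIntegral.integral_of_le hT.le]
    simp only [Matrix.mulVec, dotProduct]
    rw [intervalIntegral.integral_finsetSum
      fun j _ => ((hGram i j).intervalIntegrable h T).mul_const _]
    simp only [intervalIntegral.integral_mul_const, hGh]
  have hGp : Gh *ᵥ p = xT - Φ T 0 *ᵥ x₀ - ∫ s in (0 : ℝ)..T, Φ T s *ᵥ r s := by
    rw [hp, Matrix.mulVec_mulVec, Matrix.mul_nonsing_inv _ hGhinv, Matrix.one_mulVec]
  have hsplit : ∫ s in (0 : ℝ)..T, Φ T s *ᵥ (B s *ᵥ u (s - h) + r s)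
      = Gh *ᵥ p + ∫ s in (0 : ℝ)..T, Φ T s *ᵥ r s := by
    ext i
    simp only [Matrix.mulVec_add]
    rw [intervalIntegral_apply
        (f := fun s => Φ T s *ᵥ (B s *ᵥ u (s - h)) + Φ T s *ᵥ r s)
        (fun i => ((hΦBu i).intervalIntegrable 0 T).add
          ((hΦr i).intervalIntegrable 0 T)), Pi.add_apply,
      intervalIntegral_apply fun i => (hΦr i).intervalIntegrable 0 T, ← hsteer i]
    exact intervalIntegral.integral_add ((hΦBu i).intervalIntegrable 0 T)
      ((hΦr i).intervalIntegrable 0 T)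
  rw [hsplit, hGp]
  abel
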